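/- Let w = Π_i u_i v_i with u_i ∈ M_{e_i} and v_i ∈ M_{d_i}, and put u = Π_i u_i and v = Π_i v_i. Then: (i) (R_k(S(w)))^σ ⊆ Σ_{c} c·A + Σ_{c'} c'·f_k(S(v)), where the first sum is over monomials c of degree deg u with beta(c) ≠ beta(u) and the second is over monomials c' of degree deg u with beta(c') = beta(u); and (ii) for all n1,...,n6, R_k(w(n1,...,n6)) = ( Σ_{p1+...+p6 = deg u} u(p1,...,p6) · f_k(v(n1−p1,...,n6−p6)) )^{σ^{-1}}. -/

import Mathlib

open scoped Classical BigOperators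

noncomputable section

/-- The free associative unital `K`-algebra on six generators `x1 x2 x3 y1 y2 y3`,
realized as the monoid algebra of the free monoid on six letters. -/
abbrev FreeA (K : Type) [Field K] : Type := MonoidAlgebra K (FreeMonoid (Fin 6))

/-- The map sending the generators `x1 x2 x3` to `x` and `y1 y2 y3` to `y`. -/
def bf : Fin 6 → Fin 2 := fun i => if (i : ℕ) < 3 then 0 else 1

/-- The monoid homomorphism `β` from monomials in six letters to monomials in two letters. -/
def bm : FreeMonoid (Fin 6) →* FreeMonoid (Fin 2) := FreeMonoid.map bf

/-- Degree (length) of a monomial. -/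
def len {α : Type} (w : FreeMonoid α) : ℕ := (FreeMonoid.toList w).length

/-- The ordering `≺` on monomials in `x, y`: same degree and lexicographically smaller. -/
def prec (z z' : FreeMonoid (Fin 2)) : Prop :=
  len z = len z' ∧ List.Lex (· < ·) (FreeMonoid.toList z) (FreeMonoid.toList z')

/-- The finite set of monomials of degree `n` in six letters. -/
def wordsOf (n : ℕ) : Finset (FreeMonoid (Fin 6)) :=
  (Finset.univ : Finset (Fin n → Fin 6)).image fun f => FreeMonoid.ofList (List.ofFn f)

/-- `wComp K z n` is `z(n₁,…,n₆)`: the sum of all monomials `v` (in six letters) with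
`β v = z` and with exactly `nᵢ` occurrences of the `i`-th generator; it is `0` if no such
monomial exists (in particular if some `nᵢ` is negative). -/
def wComp (K : Type) [Field K] (z : FreeMonoid (Fin 2)) (n : Fin 6 → ℤ) : FreeA K :=
  ∑ v ∈ (wordsOf (len z)).filter
      (fun v => bm v = z ∧ ∀ e : Fin 6, ((FreeMonoid.toList v).count e : ℤ) = n e),
    MonoidAlgebra.single v 1

/-- `H_i`: the `K`-span of the monomials of degree `i`. -/
def Hgr (K : Type) [Field K] (i : ℕ) : Submodule K (FreeA K) :=
  Submodule.span K {a | ∃ w : FreeMonoid (Fin 6), len w = i ∧ a = MonoidAlgebra.single w (1 : K)}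

/-- `S(z)` for `z` a monomial in `x, y`: the span of the monomials `w` in six letters of the
same degree with `β w ≺ z`.  (For a monomial `z` in six letters, `S(z) = SP K (bm z)`.) -/
def SP (K : Type) [Field K] (z : FreeMonoid (Fin 2)) : Submodule K (FreeA K) :=
  Submodule.span K
    {a | ∃ w : FreeMonoid (Fin 6), len w = len z ∧ prec (bm w) z ∧
      a = MonoidAlgebra.single w (1 : K)}

/-- `Q(z)`: the span of the monomials `w` of the same degree with `β w = z`. -/
def QP (K : Type) [Field K] (z : FreeMonoid (Fin 2)) : Submodule K (FreeA K) :=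
  Submodule.span K
    {a | ∃ w : FreeMonoid (Fin 6), len w = len z ∧ bm w = z ∧
      a = MonoidAlgebra.single w (1 : K)}

end

noncomputable section

def wordOfFn {n : ℕ} (f : Fin n → Fin 6) : FreeMonoid (Fin 6) :=
  FreeMonoid.ofList (List.ofFn f)

end

section Words

variable {α : Type}

theorem len_mul (a b : FreeMonoid α) : len (a * b) = len a + len b := by
  simp [len, FreeMonoid.toList_mul]

theorem len_prod_ofFn {s : ℕ} (U : Fin s → FreeMonoid α) :
    len (List.ofFn U).prod = ∑ i, len (U i) := by
  induction s with
  | zero => simp [len]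
  | succ s ih => rw [List.ofFn_succ, List.prod_cons, len_mul, ih, Fin.sum_univ_succ]

theorem exists_mul_eq_of_len {a b : ℕ} {w : FreeMonoid α} (h : len w = a + b) :
    ∃ x y : FreeMonoid α, len x = a ∧ len y = b ∧ w = x * y := by
  refine ⟨FreeMonoid.ofList (w.toList.take a), FreeMonoid.ofList (w.toList.drop a), ?_, ?_, ?_⟩
  · simp only [len, FreeMonoid.toList_ofList, List.length_take] at h ⊢
    omega
  · simp only [len, FreeMonoid.toList_ofList, List.length_drop] at h ⊢
    omega
  · rw [← FreeMonoid.ofList_append, List.take_append_drop, FreeMonoid.ofList_toList]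

theorem mul_inj_of_len {a b x y : FreeMonoid α} (h : len a = len x) :
    a * b = x * y ↔ a = x ∧ b = y := by
  refine ⟨fun hab => ?_, fun ⟨ha, hb⟩ => by rw [ha, hb]⟩
  obtain ⟨h₁, h₂⟩ := List.append_inj (congrArg FreeMonoid.toList hab) h
  exact ⟨FreeMonoid.toList.injective h₁, FreeMonoid.toList.injective h₂⟩

theorem exists_blocks {s : ℕ} (e d : Fin s → ℕ) {w : FreeMonoid α}
    (h : len w = ∑ i, (e i + d i)) :
    ∃ U V : Fin s → FreeMonoid α, (∀ i, len (U i) = e i) ∧ (∀ i, len (V i) = d i) ∧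
      w = (List.ofFn fun i => U i * V i).prod := by
  induction s generalizing w with
  | zero =>
    refine ⟨fun _ => 1, fun _ => 1, fun i => i.elim0, fun i => i.elim0, ?_⟩
    exact FreeMonoid.toList.injective (by simpa [len] using h)
  | succ s ih =>
    rw [Fin.sum_univ_succ] at h
    obtain ⟨x, y, hx, hy, rfl⟩ := exists_mul_eq_of_len h
    obtain ⟨a, b, ha, hb, rfl⟩ := exists_mul_eq_of_len hx
    obtain ⟨U, V, hU, hV, rfl⟩ := ih (fun i => e i.succ) (fun i => d i.succ) hy
    refine ⟨Fin.cons a U, Fin.cons b V, ?_, ?_, ?_⟩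
    · exact Fin.cases ha hU
    · exact Fin.cases hb hV
    · simp [List.ofFn_succ]

theorem lex_append_iff {r : α → α → Prop} {a b x y : List α}
    (h : a.length = x.length) :
    List.Lex r (a ++ b) (x ++ y) ↔ List.Lex r a x ∨ a = x ∧ List.Lex r b y := by
  induction a generalizing x with
  | nil =>
    obtain rfl : x = [] := by simpa using h.symm
    simp
  | cons p a ih =>
    cases x with
    | nil => simp at h
    | cons q x =>
      have h' : a.length = x.length := by simpa using h
      simp only [List.cons_append, List.cons_lex_cons_iff, ih h', List.cons.injEq]
      tauto

theorem lex_irrefl {r : α → α → Prop} (hr : ∀ a, ¬ r a a) (l : List α) : ¬ List.Lex r l l := by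
  induction l with
  | nil => simp
  | cons p l ih => simp [List.cons_lex_cons_iff, hr, ih]

/-- If two interleaved words agree on the `U`-blocks, then comparing them lexicographically
amounts to comparing their `V`-blocks. -/
theorem lex_right_of_lex_blocks {r : α → α → Prop} (hr : ∀ a, ¬ r a a) {s : ℕ}
    {U V U' V' : Fin s → FreeMonoid α} (hU : ∀ i, len (U i) = len (U' i))
    (hV : ∀ i, len (V i) = len (V' i)) (hUU : (List.ofFn U).prod = (List.ofFn U').prod)
    (h : List.Lex r (List.ofFn fun i => U i * V i).prod.toList
      (List.ofFn fun i => U' i * V' i).prod.toList) :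
    List.Lex r (List.ofFn V).prod.toList (List.ofFn V').prod.toList := by
  induction s with
  | zero => simp at h
  | succ s ih =>
    simp only [List.ofFn_succ, List.prod_cons, mul_inj_of_len (hU 0)] at hUU
    simp only [List.ofFn_succ, List.prod_cons, mul_assoc, FreeMonoid.toList_mul] at h ⊢
    rw [lex_append_iff (hU 0), hUU.1, lex_append_iff (hV 0)] at h
    rw [lex_append_iff (hV 0)]
    rcases h with h | ⟨-, h | ⟨h, h'⟩⟩
    · exact absurd h (lex_irrefl hr _)
    · exact Or.inl h
    · exact Or.inr ⟨h, ih (fun i => hU _) (fun i => hV _) hUU.2 h'⟩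

end Words

section SixLetterWords

theorem len_bm (w : FreeMonoid (Fin 6)) : len (bm w) = len w := by
  simp [len, bm, FreeMonoid.toList_map]

theorem mem_wordsOf {n : ℕ} {w : FreeMonoid (Fin 6)} : w ∈ wordsOf n ↔ len w = n := by
  simp only [wordsOf, Finset.mem_image, Finset.mem_univ, true_and]
  constructor
  · rintro ⟨f, rfl⟩
    simp [len]
  · rintro rfl
    exact ⟨w.toList.get, congrArg FreeMonoid.ofList (List.ofFn_get _)⟩

theorem exists_wordOfFn {n : ℕ} {w : FreeMonoid (Fin 6)} (h : len w = n) :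
    ∃ f : Fin n → Fin 6, w = wordOfFn f := by
  subst h
  exact ⟨w.toList.get, (congrArg FreeMonoid.ofList (List.ofFn_get _)).symm⟩

theorem len_wordOfFn {n : ℕ} (f : Fin n → Fin 6) : len (wordOfFn f) = n := by
  simp [len, wordOfFn]

theorem wordOfFn_injective {n : ℕ} : Function.Injective (wordOfFn (n := n)) := fun _ _ h =>
  List.ofFn_injective (FreeMonoid.ofList.injective h)

theorem bm_wordOfFn_eq_iff {n : ℕ} (f g : Fin n → Fin 6) :
    bm (wordOfFn f) = bm (wordOfFn g) ↔ bf ∘ f = bf ∘ g := by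
  simp only [bm, wordOfFn, ← FreeMonoid.ofList_map, List.map_ofFn,
    FreeMonoid.ofList.injective.eq_iff, List.ofFn_injective.eq_iff]

theorem bm_prod_blocks {s : ℕ} (U : Fin s → FreeMonoid (Fin 6)) :
    bm (List.ofFn U).prod = (List.ofFn fun i => bm (U i)).prod := by
  rw [map_list_prod, List.map_ofFn]
  rfl

theorem count_wordOfFn_comp_perm {n : ℕ} (σ : Equiv.Perm (Fin n)) (f : Fin n → Fin 6)
    (a : Fin 6) : (wordOfFn (f ∘ σ)).toList.count a = (wordOfFn f).toList.count a :=
  (Equiv.Perm.ofFn_comp_perm σ f).count_eq a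

theorem sum_count (w : FreeMonoid (Fin 6)) : ∑ a, w.toList.count a = len w := by
  rw [len]
  induction w.toList with
  | nil => simp
  | cons b l ih => simp [List.count_cons, Finset.sum_add_distrib, ih]

/-- The monomials `v` with `β v = z` and `deg v = n`. -/
noncomputable def wSet (z : FreeMonoid (Fin 2)) (n : Fin 6 → ℤ) : Finset (FreeMonoid (Fin 6)) :=
  (wordsOf (len z)).filter
    (fun v => bm v = z ∧ ∀ e : Fin 6, ((FreeMonoid.toList v).count e : ℤ) = n e)

theorem mem_wSet {z : FreeMonoid (Fin 2)} {n : Fin 6 → ℤ} {v : FreeMonoid (Fin 6)} :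
    v ∈ wSet z n ↔ bm v = z ∧ ∀ e : Fin 6, ((FreeMonoid.toList v).count e : ℤ) = n e := by
  rw [wSet, Finset.mem_filter, mem_wordsOf, and_iff_right_iff_imp]
  rintro ⟨rfl, -⟩
  exact (len_bm v).symm

theorem wComp_eq_sum {K : Type} [Field K] (z : FreeMonoid (Fin 2)) (n : Fin 6 → ℤ) :
    wComp K z n = ∑ v ∈ wSet z n, MonoidAlgebra.single v 1 :=
  rfl

theorem map_wComp {K M : Type} [Field K] [AddCommGroup M] [Module K M] (L : FreeA K →ₗ[K] M)
    (z : FreeMonoid (Fin 2)) (n : Fin 6 → ℤ) :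
    L (wComp K z n) = ∑ v ∈ wSet z n, L (MonoidAlgebra.single v 1) := by
  rw [wComp_eq_sum, map_sum]

/-- Summing over monomials of type `(β (u v), n)` is summing over pairs of factors. -/
theorem sum_wSet_mul {M : Type} [AddCommMonoid M] (u v : FreeMonoid (Fin 6)) (n : Fin 6 → ℤ)
    (G : FreeMonoid (Fin 6) → M) :
    ∑ x ∈ wSet (bm (u * v)) n, G x =
      ∑ p ∈ Finset.piAntidiag Finset.univ (len u), ∑ a ∈ wSet (bm u) (fun i => (p i : ℤ)),
        ∑ b ∈ wSet (bm v) (fun i => n i - p i), G (a * b) := by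
  have hlen {a : FreeMonoid (Fin 6)} (h : bm a = bm u) : len a = len u := by
    rw [← len_bm, h, len_bm]
  simp_rw [← Finset.sum_product', Finset.sum_sigma']
  symm
  refine Finset.sum_bij (fun q _ => q.2.1 * q.2.2) ?_ ?_ ?_ ?_
  · rintro ⟨p, a, b⟩ h
    simp only [Finset.mem_sigma, Finset.mem_product, mem_wSet] at h ⊢
    obtain ⟨-, ⟨ha, ha'⟩, hb, hb'⟩ := h
    refine ⟨by rw [map_mul, map_mul, ha, hb], fun i => ?_⟩
    rw [FreeMonoid.toList_mul, List.count_append]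
    push_cast
    rw [ha', hb']
    ring
  · rintro ⟨p, a, b⟩ h ⟨q, x, y⟩ h' heq
    simp only [Finset.mem_sigma, Finset.mem_product, mem_wSet] at h h' heq
    obtain ⟨-, ⟨ha, ha'⟩, -⟩ := h
    obtain ⟨-, ⟨hx, hx'⟩, -⟩ := h'
    obtain ⟨rfl, rfl⟩ := (mul_inj_of_len ((hlen ha).trans (hlen hx).symm)).1 heq
    obtain rfl : p = q := funext fun i => by exact_mod_cast (ha' i).symm.trans (hx' i)
    rfl
  · intro x hx
    obtain ⟨hx, hx'⟩ := mem_wSet.1 hx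
    have hl : len x = len u + len v := by rw [← len_bm, hx, len_bm, len_mul]
    obtain ⟨a, b, ha, hb, rfl⟩ := exists_mul_eq_of_len hl
    rw [map_mul, map_mul, mul_inj_of_len (by rw [len_bm, len_bm, ha])] at hx
    refine ⟨⟨fun i => a.toList.count i, a, b⟩, ?_, rfl⟩
    simp only [Finset.mem_sigma, Finset.mem_product, mem_wSet, Finset.mem_piAntidiag]
    refine ⟨⟨(sum_count a).trans ha, by simp⟩, ⟨hx.1, fun _ => trivial⟩, hx.2, fun i => ?_⟩
    rw [← hx' i, FreeMonoid.toList_mul, List.count_append]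
    push_cast
    ring
  · intros
    rfl

/-- Reindexing a sum over a type of monomials along a permutation of positions. -/
theorem sum_wSet_perm {M : Type} [AddCommMonoid M] {N : ℕ} (σ : Equiv.Perm (Fin N))
    (f₀ : Fin N → Fin 6) (n : Fin 6 → ℤ) {G G' : FreeMonoid (Fin 6) → M}
    (h : ∀ f : Fin N → Fin 6, G (wordOfFn f) = G' (wordOfFn (f ∘ σ))) :
    ∑ x ∈ wSet (bm (wordOfFn f₀)) n, G x = ∑ x ∈ wSet (bm (wordOfFn (f₀ ∘ σ))) n, G' x := by
  have key (F : FreeMonoid (Fin 6) → M) (f₀ : Fin N → Fin 6) :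
      ∑ x ∈ wSet (bm (wordOfFn f₀)) n, F x =
        ∑ f : Fin N → Fin 6 with bf ∘ f = bf ∘ f₀ ∧
          ∀ a, ((wordOfFn f).toList.count a : ℤ) = n a, F (wordOfFn f) := by
    symm
    refine Finset.sum_bij (fun f _ => wordOfFn f) ?_ (fun _ _ _ _ h => wordOfFn_injective h)
      ?_ (fun _ _ => rfl)
    · intro f hf
      simpa [mem_wSet, bm_wordOfFn_eq_iff] using hf
    · intro x hx
      have hx' := mem_wSet.1 hx
      obtain ⟨f, rfl⟩ := exists_wordOfFn (n := N) (w := x)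
        (by rw [← len_bm, hx'.1, len_bm, len_wordOfFn])
      exact ⟨f, by simpa [bm_wordOfFn_eq_iff] using hx', rfl⟩
  rw [key, key]
  refine Finset.sum_equiv (σ.symm.arrowCongr (Equiv.refl _)) (fun f => ?_) (fun f _ => h f)
  have hf : σ.symm.arrowCongr (Equiv.refl _) f = f ∘ σ := rfl
  simp only [Finset.mem_filter, Finset.mem_univ, true_and, hf, count_wordOfFn_comp_perm,
    ← Function.comp_assoc, σ.surjective.right_cancellable]

end SixLetterWords

section Linear

/-- A multilinear map vanishing on products of spanning sets vanishes on products of spans. -/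
theorem MultilinearMap.eq_zero_of_mem_span {K ι E M : Type} [CommSemiring K] [Fintype ι]
    [AddCommMonoid E] [Module K E] [AddCommMonoid M] [Module K M]
    (f : MultilinearMap K (fun _ : ι => E) M) (S : ι → Set E)
    (h : ∀ x : ι → E, (∀ i, x i ∈ S i) → f x = 0) (x : ι → E)
    (hx : ∀ i, x i ∈ Submodule.span K (S i)) : f x = 0 := by
  suffices H : ∀ (T : Finset ι) (x : ι → E), (∀ i ∈ T, x i ∈ Submodule.span K (S i)) →
      (∀ i ∉ T, x i ∈ S i) → f x = 0 from
    H Finset.univ x (fun i _ => hx i) (fun i hi => absurd (Finset.mem_univ i) hi)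
  intro T
  induction T using Finset.induction_on with
  | empty => exact fun x _ hx => h x fun i => hx i (Finset.notMem_empty i)
  | insert j T hj ih =>
    intro x hT hT'
    have H : ∀ a ∈ Submodule.span K (S j), f (Function.update x j a) = 0 := by
      intro a ha
      induction ha using Submodule.span_induction with
      | mem a ha =>
        refine ih _ (fun i hi => ?_) (fun i hi => ?_)
        · have hij : i ≠ j := fun hij => hj (hij ▸ hi)
          rw [Function.update_of_ne hij]
          exact hT i (Finset.mem_insert_of_mem hi)
        · by_cases hij : i = j
          · subst hij
            rwa [Function.update_self]
          · rw [Function.update_of_ne hij]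
            exact hT' i (by simp [hij, hi])
      | zero => exact f.map_update_zero x j
      | add a b _ _ ha hb => rw [f.map_update_add, ha, hb, add_zero]
      | smul c a _ ha => rw [f.map_update_smul, ha, smul_zero]
    simpa using H (x j) (hT j (Finset.mem_insert_self j T))

theorem prod_ofFn_single {K : Type} [Field K] {s : ℕ} (W : Fin s → FreeMonoid (Fin 6)) :
    (List.ofFn fun i => (MonoidAlgebra.single (W i) 1 : FreeA K)).prod =
      MonoidAlgebra.single (List.ofFn W).prod 1 := by
  have h := map_list_prod (MonoidAlgebra.of K (FreeMonoid (Fin 6))) (List.ofFn W)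
  rw [List.map_ofFn] at h
  exact h.symm

/-- If `P` moves the `U`-blocks to the front on monomials, it does so on products of
`U`-blocks with arbitrary homogeneous elements. -/
theorem map_prod_blocks {K : Type} [Field K] {s : ℕ} (d : Fin s → ℕ) (P : FreeA K →ₗ[K] FreeA K)
    (U : Fin s → FreeMonoid (Fin 6))
    (h : ∀ V : Fin s → FreeMonoid (Fin 6), (∀ i, len (V i) = d i) →
      P (MonoidAlgebra.single (List.ofFn fun i => U i * V i).prod 1) =
        MonoidAlgebra.single ((List.ofFn U).prod * (List.ofFn V).prod) 1)
    (a : Fin s → FreeA K) (ha : ∀ i, a i ∈ Hgr K (d i)) :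
    P (List.ofFn fun i => MonoidAlgebra.single (U i) (1 : K) * a i).prod =
      MonoidAlgebra.single (List.ofFn U).prod 1 * (List.ofFn a).prod := by
  let L := P.compMultilinearMap ((MultilinearMap.mkPiAlgebraFin K s (FreeA K)).compLinearMap
    fun i => LinearMap.mulLeft K (MonoidAlgebra.single (U i) (1 : K)))
  let L' := (LinearMap.mulLeft K (MonoidAlgebra.single (List.ofFn U).prod (1 : K)
    : FreeA K)).compMultilinearMap (MultilinearMap.mkPiAlgebraFin K s (FreeA K))
  have hL (x : Fin s → FreeA K) : (L - L') x =
      P (List.ofFn fun i => MonoidAlgebra.single (U i) (1 : K) * x i).prod -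
        MonoidAlgebra.single (List.ofFn U).prod 1 * (List.ofFn x).prod := rfl
  rw [← sub_eq_zero, ← hL]
  refine MultilinearMap.eq_zero_of_mem_span _ _ (fun x hx => ?_) a ha
  choose V hV hx using hx
  obtain rfl : x = fun i => MonoidAlgebra.single (V i) 1 := funext hx
  rw [hL, sub_eq_zero, prod_ofFn_single]
  simp only [MonoidAlgebra.single_mul_single, mul_one, prod_ofFn_single]
  exact h V hV

end Linear

theorem stmt11 (K : Type) [Field K] (m : ℕ → ℕ)
    (hmono : StrictMono m) (hm1 : 10 ^ 8 < m 0)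
    (hdvd : ∀ i, 40 * m i ∣ m (i + 1)) (hgrow : ∀ i, 2 ^ (i + 102) * m i < m (i + 1))
    (F : ℕ → Finset (FreeA K)) (hF : ∀ i, (F i : Set (FreeA K)) ⊆ (Hgr K (m i) : Set (FreeA K)))
    (R c : ℕ → (FreeA K →ₗ[K] FreeA K))
    (hR0 : ∀ a ∈ Hgr K (m 0), R 0 a = a)
    (hRH : ∀ i, ∀ a ∈ Hgr K (m i), R i a ∈ Hgr K (m i))
    (hcH : ∀ i, ∀ a ∈ Hgr K (m i), c i a ∈ Hgr K (m i))
    (hcker : ∀ i, ∀ a ∈ Hgr K (m i),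
      (c i a = 0 ↔ a ∈ Submodule.span K (⇑(R i) '' (F i : Set (FreeA K)))))
    (hrec : ∀ (i : ℕ) (l : List (FreeMonoid (Fin 6))),
      l.length = m (i + 1) / m i → (∀ w ∈ l, len w = m i) →
      R (i + 1) (MonoidAlgebra.single l.prod 1) =
        c i (R i (MonoidAlgebra.single l.headI 1)) *
          (l.tail.map fun w => R i (MonoidAlgebra.single w 1)).prod)
    -- the fixed block decomposition of degree `m k`
    (k s : ℕ) (e d : Fin s → ℕ)
    (hed : 50 * (∑ i, d i) < (∑ i, e i)) (hsum : (∑ i, (e i + d i)) = m k)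
    (g : Fin s → (FreeA K →ₗ[K] FreeA K))
    (hgH : ∀ i, ∀ a ∈ Hgr K (d i), g i a ∈ Hgr K (d i))
    (hfact : ∀ U V : Fin s → FreeMonoid (Fin 6),
      (∀ i, len (U i) = e i) → (∀ i, len (V i) = d i) →
      R k (MonoidAlgebra.single (List.ofFn fun i => U i * V i).prod 1) =
        (List.ofFn fun i =>
          MonoidAlgebra.single (U i) (1 : K) * g i (MonoidAlgebra.single (V i) 1)).prod)
    -- the permutation σ and the linear maps induced by σ, σ⁻¹, and f_k
    (σ : Equiv.Perm (Fin (m k))) (Pσ Pτ fk : FreeA K →ₗ[K] FreeA K)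
    (hPσ : ∀ fn : Fin (m k) → Fin 6,
      Pσ (MonoidAlgebra.single (wordOfFn fn) 1) = MonoidAlgebra.single (wordOfFn (fn ∘ σ)) 1)
    (hPτ : ∀ fn : Fin (m k) → Fin 6,
      Pτ (MonoidAlgebra.single (wordOfFn fn) 1) = MonoidAlgebra.single (wordOfFn (fn ∘ σ.symm)) 1)
    (hσ : ∀ U V : Fin s → FreeMonoid (Fin 6),
      (∀ i, len (U i) = e i) → (∀ i, len (V i) = d i) →
      Pσ (MonoidAlgebra.single (List.ofFn fun i => U i * V i).prod 1) =
        MonoidAlgebra.single ((List.ofFn U).prod * (List.ofFn V).prod) 1)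
    (hfk : ∀ V : Fin s → FreeMonoid (Fin 6), (∀ i, len (V i) = d i) →
      fk (MonoidAlgebra.single (List.ofFn V).prod 1) =
        (List.ofFn fun i => g i (MonoidAlgebra.single (V i) 1)).prod)
    -- the data of the statement
    (U V : Fin s → FreeMonoid (Fin 6))
    (hU : ∀ i, len (U i) = e i) (hV : ∀ i, len (V i) = d i)
    (w u v : FreeMonoid (Fin 6))
    (hw : w = (List.ofFn fun i => U i * V i).prod)
    (hu : u = (List.ofFn U).prod) (hv : v = (List.ofFn V).prod) :
    ((Submodule.map Pσ (Submodule.map (R k) (SP K (bm w)))) ≤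
        Submodule.span K
          {x : FreeA K | ∃ cm : FreeMonoid (Fin 6), len cm = len u ∧ bm cm ≠ bm u ∧
            ∃ b : FreeA K, x = MonoidAlgebra.single cm 1 * b} ⊔
        Submodule.span K
          {x : FreeA K | ∃ cm : FreeMonoid (Fin 6), len cm = len u ∧ bm cm = bm u ∧
            ∃ t ∈ Submodule.map fk (SP K (bm v)), x = MonoidAlgebra.single cm 1 * t}) ∧
    (∀ n : Fin 6 → ℤ,
      R k (wComp K (bm w) n) =
        Pτ (∑ᶠ (pp : Fin 6 → ℕ) (_ : (∑ i, pp i) = len u),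
          wComp K (bm u) (fun i => (pp i : ℤ)) * fk (wComp K (bm v) (fun i => n i - pp i)))) := by
  have hlu : ∀ {U : Fin s → FreeMonoid (Fin 6)}, (∀ i, len (U i) = e i) →
      len (List.ofFn U).prod = ∑ i, e i := fun h => by
    rw [len_prod_ofFn]
    exact Finset.sum_congr rfl fun i _ => h i
  have hlv : ∀ {V : Fin s → FreeMonoid (Fin 6)}, (∀ i, len (V i) = d i) →
      len (List.ofFn V).prod = ∑ i, d i := fun h => by
    rw [len_prod_ofFn]
    exact Finset.sum_congr rfl fun i _ => h i
  have hlw : len w = m k := by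
    rw [hw, len_prod_ofFn, ← hsum]
    exact Finset.sum_congr rfl fun i _ => by rw [len_mul, hU, hV]
  have hPR : ∀ U V : Fin s → FreeMonoid (Fin 6), (∀ i, len (U i) = e i) →
      (∀ i, len (V i) = d i) →
      Pσ (R k (MonoidAlgebra.single (List.ofFn fun i => U i * V i).prod 1)) =
        MonoidAlgebra.single (List.ofFn U).prod 1 *
          fk (MonoidAlgebra.single (List.ofFn V).prod 1) := by
    intro U V hU hV
    rw [hfact U V hU hV, hfk V hV]
    exact map_prod_blocks d Pσ U (fun V hV => hσ U V hU hV) _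
      fun i => hgH i _ (Submodule.subset_span ⟨V i, hV i, rfl⟩)
  constructor
  · rw [SP, Submodule.map_span, Submodule.map_span, Submodule.span_le]
    rintro _ ⟨_, ⟨_, ⟨w', hw', hprec, rfl⟩, rfl⟩, rfl⟩
    rw [len_bm, hlw, ← hsum] at hw'
    obtain ⟨U', V', hU', hV', rfl⟩ := exists_blocks e d hw'
    rw [hPR U' V' hU' hV']
    have hlen : len (List.ofFn U').prod = len u := by rw [hu, hlu hU', hlu hU]
    by_cases hb : bm (List.ofFn U').prod = bm u
    · refine Submodule.mem_sup_right (Submodule.subset_span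
        ⟨_, hlen, hb, _, Submodule.mem_map_of_mem (Submodule.subset_span
          ⟨_, ?_, ⟨?_, ?_⟩, rfl⟩), rfl⟩)
      · rw [len_bm, hv, hlv hV', hlv hV]
      · rw [len_bm, len_bm, hv, hlv hV', hlv hV]
      · rw [hu, bm_prod_blocks, bm_prod_blocks] at hb
        have hlex := hprec.2
        rw [hw, bm_prod_blocks, bm_prod_blocks] at hlex
        simp only [map_mul] at hlex
        rw [hv, bm_prod_blocks, bm_prod_blocks]
        exact lex_right_of_lex_blocks (fun a => lt_irrefl a)
          (fun i => by rw [len_bm, len_bm, hU, hU']) (fun i => by rw [len_bm, len_bm, hV, hV'])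
          hb hlex
    · exact Submodule.mem_sup_left (Submodule.subset_span ⟨_, hlen, hb, _, rfl⟩)
  · intro n
    have hinv : ∀ a ∈ Hgr K (m k), Pτ (Pσ a) = a := by
      intro a ha
      refine LinearMap.eqOn_span (f := Pτ ∘ₗ Pσ) (g := LinearMap.id) ?_ ha
      rintro _ ⟨x, hx, rfl⟩
      obtain ⟨f, rfl⟩ := exists_wordOfFn hx
      simp [hPσ, hPτ, Function.comp_assoc]
    let split : FreeMonoid (Fin 6) → FreeA K := fun x =>
      MonoidAlgebra.single (FreeMonoid.ofList (x.toList.take (∑ i, e i))) 1 *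
        fk (MonoidAlgebra.single (FreeMonoid.ofList (x.toList.drop (∑ i, e i))) 1)
    have hsplit : ∀ a b : FreeMonoid (Fin 6), len a = ∑ i, e i →
        split (a * b) = MonoidAlgebra.single a 1 * fk (MonoidAlgebra.single b 1) := by
      intro a b h
      simp only [split, FreeMonoid.toList_mul]
      rw [List.take_left' h, List.drop_left' h, FreeMonoid.ofList_toList, FreeMonoid.ofList_toList]
    have hperm : ∀ (f : Fin (m k) → Fin 6) (U V : Fin s → FreeMonoid (Fin 6)),
        (∀ i, len (U i) = e i) → (∀ i, len (V i) = d i) →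
        wordOfFn f = (List.ofFn fun i => U i * V i).prod →
        wordOfFn (f ∘ σ) = (List.ofFn U).prod * (List.ofFn V).prod := by
      intro f U V hU hV hf
      have h := hσ U V hU hV
      rw [← hf, hPσ] at h
      exact MonoidAlgebra.single_left_injective one_ne_zero h
    have hterm : ∀ f : Fin (m k) → Fin 6, R k (MonoidAlgebra.single (wordOfFn f) 1) =
        Pτ (split (wordOfFn (f ∘ σ))) := by
      intro f
      obtain ⟨U', V', hU', hV', hf⟩ := exists_blocks e d ((len_wordOfFn f).trans hsum.symm)
      rw [hperm f U' V' hU' hV' hf, hsplit _ _ (hlu hU'), ← hPR U' V' hU' hV', ← hf]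
      exact (hinv _ (hRH k _ (Submodule.subset_span ⟨_, len_wordOfFn f, rfl⟩))).symm
    obtain ⟨f₀, hf₀⟩ := exists_wordOfFn hlw
    have huv : wordOfFn (f₀ ∘ σ) = u * v := by
      rw [hperm f₀ U V hU hV (hf₀.symm.trans hw), hu, hv]
    rw [map_wComp, hf₀, sum_wSet_perm σ f₀ n (G' := fun x => Pτ (split x)) hterm, huv,
      ← map_sum, sum_wSet_mul]
    congr 1
    trans ∑ p ∈ Finset.piAntidiag Finset.univ (len u), wComp K (bm u) (fun i => (p i : ℤ)) *
      fk (wComp K (bm v) (fun i => n i - p i))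
    · refine Finset.sum_congr rfl fun p _ => ?_
      rw [map_wComp fk, wComp_eq_sum, Finset.sum_mul_sum]
      refine Finset.sum_congr rfl fun a ha => Finset.sum_congr rfl fun b _ => hsplit a b ?_
      rw [← len_bm, (mem_wSet.1 ha).1, len_bm, hu, hlu hU]
    · rw [← finsum_mem_coe_finset]
      simp [Finset.mem_piAntidiag]
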